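/- arXiv:1407.3247 — 6 statements merged into one kernel-verified Lean document; each statement's English description precedes it below -/
import Mathlib

section
/- Let G = (V, E) be a finite simple graph with maximum degree Δ ≥ 2 and let t be a natural number. Construct the following approval profile: the candidate set is C = {c_v : v ∈ V} ∪ {d_{v,j} : v ∈ V, 1 ≤ j ≤ Δ − deg(v)}; for each edge {u, v} ∈ E there is one agent with ballot {c_u, c_v}, and for each v ∈ V and each 1 ≤ j ≤ Δ − deg(v) there is one agent with ballot {c_v, d_{v,j}}. Then there exists a committee W ⊆ C with |W| = t and PAV(W) ≥ Δ·t if and only if G has an independent set of size t (a set S ⊆ V of size t such that no edge of G has both endpoints in S). -/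
open Finset

/-- The harmonic number `H(p) = 1 + 1/2 + ⋯ + 1/p`, with `H(0) = 0`. -/
def harm (p : ℕ) : ℚ := ∑ j ∈ Finset.range p, (1 : ℚ) / (j + 1)

/-- The PAV score of a committee `W` under the approval profile `A`. -/
def pavScore {C I : Type*} [Fintype I] [DecidableEq C] (A : I → Finset C) (W : Finset C) : ℚ :=
  ∑ i, harm ((W ∩ A i).card)

variable {V : Type*} [Fintype V] [DecidableEq V]

/-- Candidates: one candidate `c_v` for each vertex `v` (left summand) and
`Δ - deg v` dummy candidates `d_{v,j}` for each vertex `v` (right summand). -/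
abbrev PavCand (G : SimpleGraph V) [DecidableRel G.Adj] : Type _ :=
  V ⊕ (Σ v : V, Fin (G.maxDegree - G.degree v))

/-- Agents: one agent per edge of `G` (left summand) and one agent per dummy
candidate `d_{v,j}` (right summand). -/
abbrev PavAgent (G : SimpleGraph V) [DecidableRel G.Adj] : Type _ :=
  {e : Sym2 V // e ∈ G.edgeFinset} ⊕ (Σ v : V, Fin (G.maxDegree - G.degree v))

/-- The ballots: the agent of edge `{u,v}` approves `{c_u, c_v}`; the agent of
dummy candidate `d_{v,j}` approves `{c_v, d_{v,j}}`. -/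
def pavBallot (G : SimpleGraph V) [DecidableRel G.Adj] : PavAgent G → Finset (PavCand G)
  | Sum.inl e =>
      Sym2.lift ⟨fun u v => ({Sum.inl u, Sum.inl v} : Finset (PavCand G)),
        fun u v => Finset.pair_comm _ _⟩ e.1
  | Sum.inr ⟨v, j⟩ => {Sum.inl v, Sum.inr ⟨v, j⟩}

theorem harm_le_natCast (p : ℕ) : harm p ≤ p := by
  calc harm p ≤ ∑ _j ∈ Finset.range p, (1 : ℚ) := by
        refine Finset.sum_le_sum fun j _ => ?_
        rw [div_le_one (by positivity)]
        linarith [Nat.cast_nonneg (α := ℚ) j]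
    _ = p := by simp

theorem harm_eq_natCast_iff {p : ℕ} : harm p = p ↔ p ≤ 1 := by
  constructor
  · intro h
    by_contra! hp
    obtain ⟨q, rfl⟩ : ∃ q, p = q + 1 := ⟨p - 1, by omega⟩
    have hq : (1 : ℚ) ≤ q := by exact_mod_cast (by omega : 1 ≤ q)
    have hlt : (1 : ℚ) / (q + 1) < 1 := by
      rw [div_lt_one (by positivity)]
      linarith
    have hle := harm_le_natCast q
    rw [harm, Finset.sum_range_succ, ← harm] at h
    push_cast at h
    linarith
  · intro h
    interval_cases p <;> simp [harm]

/-- Counting approvals by agent or by committee member gives the same total. -/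
theorem sum_card_inter_ballot {C I : Type*} [Fintype I] [DecidableEq C] (A : I → Finset C)
    (W : Finset C) : ∑ i, (W ∩ A i).card = ∑ c ∈ W, #{i | c ∈ A i} := by
  simp_rw [← Finset.filter_mem_eq_inter, Finset.card_filter]
  exact Finset.sum_comm

theorem pavScore_le_sum_card {C I : Type*} [Fintype I] [DecidableEq C] (A : I → Finset C)
    (W : Finset C) : pavScore A W ≤ ((∑ i, (W ∩ A i).card : ℕ) : ℚ) := by
  push_cast
  exact Finset.sum_le_sum fun i _ => harm_le_natCast _

theorem pavScore_eq_sum_card_iff {C I : Type*} [Fintype I] [DecidableEq C] (A : I → Finset C)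
    (W : Finset C) :
    pavScore A W = ((∑ i, (W ∩ A i).card : ℕ) : ℚ) ↔ ∀ i, (W ∩ A i).card ≤ 1 := by
  push_cast
  rw [pavScore, Finset.sum_eq_sum_iff_of_le fun i _ => harm_le_natCast _]
  simp [harm_eq_natCast_iff]

section Ballot

variable (G : SimpleGraph V) [DecidableRel G.Adj]

theorem inl_mem_pavBallot_inl (v : V) (e : {e : Sym2 V // e ∈ G.edgeFinset}) :
    Sum.inl v ∈ pavBallot G (Sum.inl e) ↔ v ∈ e.1 := by
  obtain ⟨e, he⟩ := e
  induction e with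
  | h a b => simp [pavBallot]

theorem inr_notMem_pavBallot_inl (d : Σ v : V, Fin (G.maxDegree - G.degree v))
    (e : {e : Sym2 V // e ∈ G.edgeFinset}) :
    Sum.inr d ∉ pavBallot G (Sum.inl e) := by
  obtain ⟨e, he⟩ := e
  induction e with
  | h a b => simp [pavBallot]

theorem inl_mem_pavBallot_inr (v : V) (d : Σ v : V, Fin (G.maxDegree - G.degree v)) :
    Sum.inl v ∈ pavBallot G (Sum.inr d) ↔ v = d.1 := by
  simp [pavBallot]

theorem inr_mem_pavBallot_inr (d d' : Σ v : V, Fin (G.maxDegree - G.degree v)) :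
    Sum.inr d ∈ pavBallot G (Sum.inr d') ↔ d = d' := by
  simp [pavBallot]

theorem card_approvers_inl (v : V) :
    #{i | Sum.inl v ∈ pavBallot G i} = G.maxDegree := by
  rw [Finset.card_filter, Fintype.sum_sum_type]
  simp only [inl_mem_pavBallot_inl, inl_mem_pavBallot_inr]
  have hedge : ∑ e : {e : Sym2 V // e ∈ G.edgeFinset}, (if v ∈ e.1 then 1 else 0)
      = G.degree v := by
    rw [← G.card_incidenceFinset_eq_degree, G.incidenceFinset_eq_filter, Finset.card_filter]
    exact Finset.sum_coe_sort G.edgeFinset fun e => if v ∈ e then 1 else 0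
  have hdummy : ∑ d : (Σ v : V, Fin (G.maxDegree - G.degree v)), (if v = d.1 then 1 else 0)
      = G.maxDegree - G.degree v := by
    rw [Fintype.sum_sigma, Fintype.sum_eq_single v fun u hu => by simp [hu.symm]]
    simp
  rw [hedge, hdummy]
  exact Nat.add_sub_cancel' (G.degree_le_maxDegree v)

theorem card_approvers_inr (d : Σ v : V, Fin (G.maxDegree - G.degree v)) :
    #{i | Sum.inr d ∈ pavBallot G i} = 1 := by
  rw [Finset.card_filter, Fintype.sum_sum_type]
  simp [inr_notMem_pavBallot_inl, inr_mem_pavBallot_inr]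

end Ballot

/-- There is a committee of size `t` with PAV score at least `Δ · t` iff
`G` has an independent set of size `t`. -/
theorem pav_winning_committee_iff_independent_set
    (G : SimpleGraph V) [DecidableRel G.Adj] (hΔ : 2 ≤ G.maxDegree) (t : ℕ) :
    (∃ W : Finset (PavCand G), W.card = t ∧
        (G.maxDegree * t : ℚ) ≤ pavScore (pavBallot G) W) ↔
      (∃ S : Finset V, S.card = t ∧ ∀ u ∈ S, ∀ v ∈ S, ¬ G.Adj u v) := by
  constructor
  · rintro ⟨W, hW, hscore⟩
    have happ : ∀ c ∈ W, #{i | c ∈ pavBallot G i} ≤ G.maxDegree := by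
      rintro (v | d) -
      · rw [card_approvers_inl]
      · rw [card_approvers_inr]
        omega
    have hconst : ∑ _c ∈ W, G.maxDegree = G.maxDegree * t := by
      rw [Finset.sum_const, hW, smul_eq_mul, mul_comm]
    have htotal : ∑ i, (W ∩ pavBallot G i).card ≤ G.maxDegree * t := by
      rw [sum_card_inter_ballot, ← hconst]
      exact Finset.sum_le_sum happ
    have htotal_cast : ((∑ i, (W ∩ pavBallot G i).card : ℕ) : ℚ) ≤ G.maxDegree * t := by
      exact_mod_cast htotal
    have hle := pavScore_le_sum_card (pavBallot G) W
    have hone := (pavScore_eq_sum_card_iff (pavBallot G) W).1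
      (le_antisymm hle (htotal_cast.trans hscore))
    have hsum : ∑ c ∈ W, #{i | c ∈ pavBallot G i} = ∑ _c ∈ W, G.maxDegree := by
      rw [← sum_card_inter_ballot, hconst]
      exact le_antisymm htotal (by exact_mod_cast hscore.trans hle)
    rw [Finset.sum_eq_sum_iff_of_le happ] at hsum
    have hright : W.toRight = ∅ := by
      refine Finset.eq_empty_of_forall_notMem fun d hd => ?_
      have := hsum _ (Finset.mem_toRight.1 hd)
      rw [card_approvers_inr] at this
      omega
    refine ⟨W.toLeft, ?_, fun u hu v hv huv => ?_⟩
    · have := W.card_toLeft_add_card_toRight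
      rwa [hright, Finset.card_empty, add_zero, hW] at this
    · have := Finset.card_le_one.1
        (hone (Sum.inl ⟨s(u, v), by simpa using huv⟩)) (Sum.inl u)
        (by simpa [inl_mem_pavBallot_inl] using hu) (Sum.inl v)
        (by simpa [inl_mem_pavBallot_inl] using hv)
      exact huv.ne (Sum.inl_injective this)
  · rintro ⟨S, rfl, hS⟩
    refine ⟨S.map Function.Embedding.inl, Finset.card_map _, ?_⟩
    rw [(pavScore_eq_sum_card_iff _ _).2, sum_card_inter_ballot, Finset.sum_map]
    · simp [card_approvers_inl, mul_comm]
    · intro i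
      rw [Finset.card_le_one]
      simp only [Finset.mem_inter, Finset.mem_map, Function.Embedding.inl_apply]
      rintro _ ⟨⟨a, ha, rfl⟩, hai⟩ _ ⟨⟨b, hb, rfl⟩, hbi⟩
      congr 1
      rcases i with ⟨e, he⟩ | d
      · rw [inl_mem_pavBallot_inl] at hai hbi
        dsimp only at hai hbi
        by_contra hab
        rw [(Sym2.mem_and_mem_iff hab).1 ⟨hai, hbi⟩, SimpleGraph.mem_edgeFinset,
          SimpleGraph.mem_edgeSet] at he
        exact hS a ha b hb he
      · rw [inl_mem_pavBallot_inr] at hai hbi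
        exact hai.trans hbi.symm
end

section
/- PAV is not strategyproof with dichotomous preferences: there exist a finite candidate set C, a linear order ≻ on C, a committee size k, approval ballots A_2, …, A_n over C, a truthful approval set T ⊆ C, and a ballot B ⊆ C such that |W(B) ∩ T| > |W(T) ∩ T|, where for a ballot X the committee W(X) is the size-k subset of C maximizing the PAV score of the profile (X, A_2, …, A_n), with ties among maximizing committees broken by choosing the committee that is lexicographically preferred with respect to ≻. -/
open Finset

/-- `W` is (weakly) lexicographically preferred to `W'` with respect to the
tie-breaking linear order: either they are equal, or the earliest candidate on
which they differ belongs to `W`. -/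
def LexPref {C : Type*} [LinearOrder C] (W W' : Finset C) : Prop :=
  W = W' ∨ ∃ c, c ∈ W ∧ c ∉ W' ∧ ∀ d, d < c → (d ∈ W ↔ d ∈ W')

/-- `W` is the PAV winning committee of size `k`: it maximizes the PAV score
among size-`k` committees, and among all maximizing size-`k` committees it is
the lexicographically preferred one. -/
def IsPAVWinner {C I : Type*} [Fintype C] [LinearOrder C] [Fintype I]
    (A : I → Finset C) (k : ℕ) (W : Finset C) : Prop :=
  W.card = k ∧
    (∀ W' : Finset C, W'.card = k → pavScore A W' ≤ pavScore A W) ∧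
    (∀ W' : Finset C, W'.card = k → pavScore A W' = pavScore A W → LexPref W W')

instance {C : Type*} [Fintype C] [LinearOrder C] (W W' : Finset C) : Decidable (LexPref W W') := by
  unfold LexPref
  infer_instance

instance {C I : Type*} [Fintype C] [LinearOrder C] [Fintype I]
    (A : I → Finset C) (k : ℕ) (W : Finset C) : Decidable (IsPAVWinner A k W) := by
  unfold IsPAVWinner
  infer_instance

/-- PAV is not strategyproof with dichotomous preferences: there are a finite
candidate set (with tie-breaking linear order), a committee size `k`, ballots
`A_2, …, A_n` of the other agents, a truthful approval set `T` and a ballot `B`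
such that the PAV winning committee when agent 1 reports `B` gives agent 1
strictly more dichotomous utility `|W ∩ T|` than the winning committee when
agent 1 reports `T` truthfully. -/
theorem pav_not_strategyproof :
    ∃ (m n k : ℕ) (A : Fin n → Finset (Fin m)) (T B WT WB : Finset (Fin m)),
      IsPAVWinner (Fin.cons T A) k WT ∧
      IsPAVWinner (Fin.cons B A) k WB ∧
      (WT ∩ T).card < (WB ∩ T).card := by
  -- Hiding the approval of candidate `0`, which wins anyway, gains candidate `1` by tie-breaking.
  refine ⟨3, 2, 2, ![{0}, {2}], {0, 1}, {1}, {0, 2}, {0, 1}, ?_, ?_, ?_⟩ <;> decide +kernel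
end

section
/- Let C = {a, b, c, d, e, f, g} with tie-breaking linear order a ≻ b ≻ c ≻ d ≻ e ≻ f ≻ g and committee size k = 3. Suppose one agent casts ballot {a, b} and three agents each cast ballot {d, e, f, g}. Then: (i) if two additional agents cast the ballots {c} and {a, b} respectively, the SAV winning set is {a, b, c}; but (ii) there is no single nonempty ballot B ⊆ C such that when both additional agents cast the identical ballot B, the SAV winning set is {a, b, c}. Hence a manipulating coalition may need to cast non-identical votes to ensure a given set of candidates is selected under SAV. -/
open Finset

/-- The SAV score of a candidate `c`: each agent approving `c` contributes
`1/|A_i|`. -/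
def savScore {C I : Type*} [Fintype I] [DecidableEq C] (A : I → Finset C) (c : C) : ℚ :=
  ∑ i ∈ Finset.univ.filter (fun i => c ∈ A i), (1 : ℚ) / ((A i).card)

/-- `W` is the SAV winning set of size `k` for the profile `A` with tie-breaking
order `prec` (`prec c d` meaning that `c` is earlier, i.e. preferred, in the
tie-breaking order): `W` consists of the `k` candidates with highest SAV score,
ties broken in favor of earlier candidates. -/
def IsSAVWinningSet {C I : Type*} [Fintype I] [DecidableEq C]
    (A : I → Finset C) (prec : C → C → Prop) (k : ℕ) (W : Finset C) : Prop :=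
  W.card = k ∧ ∀ c ∈ W, ∀ d, d ∉ W →
    savScore A d < savScore A c ∨ (savScore A d = savScore A c ∧ prec c d)

/-- The profile with candidates `a,…,g = 0,…,6`: one agent approves `{a,b}`,
three agents approve `{d,e,f,g}`, and two additional (manipulating) agents cast
ballots `B₁` and `B₂`. -/
def savProfile7 (B₁ B₂ : Finset (Fin 7)) : Fin 6 → Finset (Fin 7) :=
  ![{0, 1}, {3, 4, 5, 6}, {3, 4, 5, 6}, {3, 4, 5, 6}, B₁, B₂]

theorem savScore_savProfile7 (B₁ B₂ : Finset (Fin 7)) (c : Fin 7) :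
    savScore (savProfile7 B₁ B₂) c =
      (if c ∈ ({0, 1} : Finset (Fin 7)) then 1 / 2 else 0) +
      (if c ∈ ({3, 4, 5, 6} : Finset (Fin 7)) then 3 / 4 else 0) +
      (if c ∈ B₁ then 1 / (B₁.card : ℚ) else 0) +
      (if c ∈ B₂ then 1 / (B₂.card : ℚ) else 0) := by
  have h₂ : (({0, 1} : Finset (Fin 7)).card : ℚ) = 2 := by
    exact_mod_cast (by decide : ({0, 1} : Finset (Fin 7)).card = 2)
  have h₄ : (({3, 4, 5, 6} : Finset (Fin 7)).card : ℚ) = 4 := by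
    exact_mod_cast (by decide : ({3, 4, 5, 6} : Finset (Fin 7)).card = 4)
  rw [savScore, Finset.sum_filter, Fin.sum_univ_six]
  change (if c ∈ ({0, 1} : Finset (Fin 7)) then
        1 / (({0, 1} : Finset (Fin 7)).card : ℚ) else 0) +
      (if c ∈ ({3, 4, 5, 6} : Finset (Fin 7)) then
        1 / (({3, 4, 5, 6} : Finset (Fin 7)).card : ℚ) else 0) +
      (if c ∈ ({3, 4, 5, 6} : Finset (Fin 7)) then
        1 / (({3, 4, 5, 6} : Finset (Fin 7)).card : ℚ) else 0) +
      (if c ∈ ({3, 4, 5, 6} : Finset (Fin 7)) then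
        1 / (({3, 4, 5, 6} : Finset (Fin 7)).card : ℚ) else 0) +
      (if c ∈ B₁ then 1 / (B₁.card : ℚ) else 0) +
      (if c ∈ B₂ then 1 / (B₂.card : ℚ) else 0) = _
  rw [h₂, h₄]
  split_ifs <;> ring

theorem IsSAVWinningSet.savScore_le {C I : Type*} [Fintype I] [DecidableEq C]
    {A : I → Finset C} {prec : C → C → Prop} {k : ℕ} {W : Finset C}
    (h : IsSAVWinningSet A prec k W) {c d : C} (hc : c ∈ W) (hd : d ∉ W) :
    savScore A d ≤ savScore A c :=
  (h.2 c hc d hd).elim le_of_lt fun h => h.1.le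

/-- Under SAV with tie-breaking order `a ≻ b ≻ ⋯ ≻ g` and `k = 3`, the two
additional agents can make `{a,b,c}` the winning set by casting `{c}` and
`{a,b}`, but no identical pair of nonempty ballots achieves this: a
manipulating coalition may need to cast non-identical votes. -/
theorem sav_coalition_may_need_nonidentical_votes :
    IsSAVWinningSet (savProfile7 {2} {0, 1}) (· < ·) 3 {0, 1, 2} ∧
    ¬ ∃ B : Finset (Fin 7), B.Nonempty ∧
        IsSAVWinningSet (savProfile7 B B) (· < ·) 3 {0, 1, 2} := by
  refine ⟨⟨by decide, fun c hc d hd => Or.inl ?_⟩, ?_⟩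
  · rw [savScore_savProfile7, savScore_savProfile7]
    fin_cases c <;> fin_cases d <;> first
      | exact absurd hc (by decide)
      | exact absurd (by decide) hd
      | (simp; try norm_num)
  · rintro ⟨B, hB, h⟩
    have hpos : 0 < 1 / (B.card : ℚ) := by
      have := hB.card_pos
      positivity
    have ha := h.savScore_le (c := 0) (d := 3) (by decide) (by decide)
    have hb := h.savScore_le (c := 1) (d := 3) (by decide) (by decide)
    have hc := h.savScore_le (c := 2) (d := 3) (by decide) (by decide)
    simp only [savScore_savProfile7, show (0 : Fin 7) ∈ ({0, 1} : Finset (Fin 7)) by decide,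
      show (1 : Fin 7) ∈ ({0, 1} : Finset (Fin 7)) by decide,
      show (2 : Fin 7) ∉ ({0, 1} : Finset (Fin 7)) by decide,
      show (3 : Fin 7) ∉ ({0, 1} : Finset (Fin 7)) by decide,
      show (0 : Fin 7) ∉ ({3, 4, 5, 6} : Finset (Fin 7)) by decide,
      show (1 : Fin 7) ∉ ({3, 4, 5, 6} : Finset (Fin 7)) by decide,
      show (2 : Fin 7) ∉ ({3, 4, 5, 6} : Finset (Fin 7)) by decide,
      show (3 : Fin 7) ∈ ({3, 4, 5, 6} : Finset (Fin 7)) by decide, if_true, if_false]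
      at ha hb hc
    have hd' : 0 ≤ if (3 : Fin 7) ∈ B then 1 / (B.card : ℚ) else 0 := by
      split_ifs <;> linarith
    have h0 : (0 : Fin 7) ∈ B := by
      by_contra hn
      rw [if_neg hn] at ha
      linarith
    have h1 : (1 : Fin 7) ∈ B := by
      by_contra hn
      rw [if_neg hn] at hb
      linarith
    have h2 : (2 : Fin 7) ∈ B := by
      by_contra hn
      rw [if_neg hn] at hc
      linarith
    have hsub : ({0, 1, 2} : Finset (Fin 7)) ⊆ B := by
      simp [Finset.insert_subset_iff, h0, h1, h2]
    have hcard : (3 : ℚ) ≤ B.card := by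
      exact_mod_cast Finset.card_le_card hsub
    have hle : 1 / (B.card : ℚ) ≤ 1 / 3 := one_div_le_one_div_of_le (by norm_num) hcard
    rw [if_pos h2] at hc
    linarith
end

section
/- Fix a finite candidate set C, approval ballots A_2, …, A_n ⊆ C, a committee size k, a tie-breaking linear order ≻ on C, and a set P ⊆ C with |P| = k. For every ballot B ⊆ C: if the RAV outcome of the profile (B, A_2, …, A_n) equals P, then the RAV outcome of the profile (B ∩ P, A_2, …, A_n) also equals P. In particular, an agent who wants the winning set to be exactly P never has an incentive to approve any candidate outside P (never has an incentive to approve a strict superset of P). -/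
open Finset

/-- The RAV round score of candidate `c` given the already-elected committee
`W`: each agent `i` approving `c` contributes weight `1/(1 + |W ∩ A_i|)`. -/
def ravRoundScore {C I : Type*} [Fintype I] [DecidableEq C]
    (A : I → Finset C) (W : Finset C) (c : C) : ℚ :=
  ∑ i ∈ Finset.univ.filter (fun i => c ∈ A i), (1 : ℚ) / (1 + (W ∩ A i).card)

/-- `c` is the candidate elected by RAV in the round following committee `W`:
`c ∉ W` and `c` beats every other unelected candidate, either strictly in round
score or by the tie-breaking order `prec` (`prec c d` meaning `c` is earlier,
i.e. preferred). -/
def IsRAVChoice {C I : Type*} [Fintype I] [DecidableEq C]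
    (A : I → Finset C) (prec : C → C → Prop) (W : Finset C) (c : C) : Prop :=
  c ∉ W ∧ ∀ d, d ∉ W → d ≠ c →
    ravRoundScore A W d < ravRoundScore A W c ∨
      (ravRoundScore A W d = ravRoundScore A W c ∧ prec c d)

/-- `l` is a valid sequence of RAV rounds, listed most recent first: each entry
is the RAV choice given the set of previously elected candidates. -/
def IsRAVSeq {C I : Type*} [Fintype I] [DecidableEq C]
    (A : I → Finset C) (prec : C → C → Prop) : List C → Prop
  | [] => True
  | c :: l => IsRAVSeq A prec l ∧ IsRAVChoice A prec l.toFinset c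

/-- `W` is the outcome of `k` rounds of RAV on profile `A` with tie-breaking
order `prec`. -/
def IsRAVOutcome {C I : Type*} [Fintype I] [DecidableEq C]
    (A : I → Finset C) (prec : C → C → Prop) (k : ℕ) (W : Finset C) : Prop :=
  ∃ l : List C, l.length = k ∧ IsRAVSeq A prec l ∧ W = l.toFinset

section Restriction

variable {C I : Type*} [DecidableEq C] {A A' : I → Finset C} {P W : Finset C}

lemma inter_eq_inter_of_subset_of_inter_eq {S T : Finset C} (h : S ∩ P = T ∩ P)
    (hW : W ⊆ P) : W ∩ S = W ∩ T := by
  rw [← inter_eq_left.mpr hW, inter_assoc, inter_assoc, inter_comm P S, inter_comm P T, h]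

variable [Fintype I]

/-- Shrinking ballots without changing them on `P ⊇ W` does not increase any round score. -/
lemma ravRoundScore_le_of_subset (hsub : ∀ i, A' i ⊆ A i) (heq : ∀ i, A' i ∩ P = A i ∩ P)
    (hW : W ⊆ P) (c : C) : ravRoundScore A' W c ≤ ravRoundScore A W c := by
  simp only [ravRoundScore, inter_eq_inter_of_subset_of_inter_eq (heq _) hW]
  refine sum_le_sum_of_subset_of_nonneg ?_ fun i _ _ => by positivity
  exact monotone_filter_right _ fun i _ hi => hsub i hi

/-- The round score of a member of `P ⊇ W` depends only on the ballots restricted to `P`. -/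
lemma ravRoundScore_eq_of_inter_eq (heq : ∀ i, A' i ∩ P = A i ∩ P) (hW : W ⊆ P) {c : C}
    (hc : c ∈ P) : ravRoundScore A' W c = ravRoundScore A W c := by
  have hmem : ∀ i, c ∈ A' i ↔ c ∈ A i := fun i => by
    simpa [hc] using congrArg (c ∈ ·) (heq i)
  simp only [ravRoundScore, inter_eq_inter_of_subset_of_inter_eq (heq _) hW, hmem]

lemma IsRAVChoice.of_subset {prec : C → C → Prop} (hsub : ∀ i, A' i ⊆ A i)
    (heq : ∀ i, A' i ∩ P = A i ∩ P) (hW : W ⊆ P) {c : C} (hc : c ∈ P)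
    (h : IsRAVChoice A prec W c) : IsRAVChoice A' prec W c := by
  refine ⟨h.1, fun d hd hdc => ?_⟩
  rw [ravRoundScore_eq_of_inter_eq heq hW hc]
  have hle := ravRoundScore_le_of_subset hsub heq hW d
  rcases h.2 d hd hdc with hlt | ⟨he, hp⟩
  · exact Or.inl (hle.trans_lt hlt)
  · exact (hle.trans_eq he).lt_or_eq.imp_right fun h' => ⟨h', hp⟩

lemma IsRAVSeq.of_subset {prec : C → C → Prop} (hsub : ∀ i, A' i ⊆ A i)
    (heq : ∀ i, A' i ∩ P = A i ∩ P) {l : List C} (hl : l.toFinset ⊆ P)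
    (h : IsRAVSeq A prec l) : IsRAVSeq A' prec l := by
  induction l with
  | nil => trivial
  | cons c l ih =>
    rw [List.toFinset_cons, insert_subset_iff] at hl
    exact ⟨ih hl.2 h.1, h.2.of_subset hsub heq hl.2 hl.1⟩

end Restriction

/-- If casting the ballot `B` makes the RAV outcome exactly the size-`k` set
`P`, then casting `B ∩ P` also makes the RAV outcome exactly `P`: an agent who
wants the winning set to be exactly `P` never has an incentive to approve any
candidate outside `P`. -/
theorem rav_exact_set_no_incentive_outside
    {C : Type*} [Fintype C] [LinearOrder C] {n : ℕ}
    (A : Fin n → Finset C) (k : ℕ) (P : Finset C) (hP : P.card = k)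
    (B : Finset C)
    (h : IsRAVOutcome (Fin.cons B A) (· < ·) k P) :
    IsRAVOutcome (Fin.cons (B ∩ P) A) (· < ·) k P := by
  obtain ⟨l, hlen, hl, hPl⟩ := h
  refine ⟨l, hlen, hl.of_subset (P := P) ?_ ?_ hPl.ge, hPl⟩
  · exact Fin.cases inter_subset_left fun _ => Subset.rfl
  · exact Fin.cases (by simp [inter_assoc]) fun _ => rfl
end

section
/- Fix a finite candidate set C, nonempty approval ballots A_1, …, A_n ⊆ C, a committee size k ≤ |C|, a tie-breaking linear order ≻ on C, a candidate p ∈ C, and a number j of additional agents. If there exist nonempty ballots B_1, …, B_j ⊆ C such that p belongs to the SAV winning set of the profile (A_1, …, A_n, B_1, …, B_j), then p belongs to the SAV winning set of the profile (A_1, …, A_n, {p}, …, {p}) in which each of the j additional agents casts the singleton ballot {p}. Hence, to make p a winner under SAV, it is optimal for the additional agents to approve only p. -/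
open Finset

/-- Every function into a linear order admits a set of `k` points carrying its largest values. -/
theorem exists_card_eq_forall_le {C K : Type*} [Fintype C] [LinearOrder K]
    (f : C → K) {k : ℕ} (hk : k ≤ Fintype.card C) :
    ∃ W : Finset C, W.card = k ∧ ∀ c ∈ W, ∀ d, d ∉ W → f d ≤ f c := by
  classical
  induction k with
  | zero => exact ⟨∅, by simp⟩
  | succ k ih =>
    obtain ⟨W, hcard, hW⟩ := ih (by omega)
    have hne : Wᶜ.Nonempty := by
      rw [← Finset.card_pos, Finset.card_compl]
      omega
    obtain ⟨m, hm, hmax⟩ := Finset.exists_max_image Wᶜ f hne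
    rw [Finset.mem_compl] at hm
    refine ⟨insert m W, by rw [Finset.card_insert_of_notMem hm, hcard], fun c hc d hd => ?_⟩
    rw [Finset.mem_insert, not_or] at hd
    rcases Finset.mem_insert.1 hc with rfl | hc
    · exact hmax d (Finset.mem_compl.2 hd.2)
    · exact hW c hc d hd.2

theorem exists_isSAVWinningSet {C I : Type*} [Fintype I] [Fintype C] [LinearOrder C]
    (A : I → Finset C) {k : ℕ} (hk : k ≤ Fintype.card C) :
    ∃ W : Finset C, IsSAVWinningSet A (· < ·) k W := by
  obtain ⟨W, hcard, hW⟩ :=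
    exists_card_eq_forall_le (fun c => toLex (savScore A c, OrderDual.toDual c)) hk
  refine ⟨W, hcard, fun c hc d hd => ?_⟩
  rcases Prod.Lex.toLex_le_toLex.1 (hW c hc d hd) with h | ⟨h, hle⟩
  · exact Or.inl h
  · refine Or.inr ⟨h, lt_of_le_of_ne (OrderDual.toDual_le_toDual.1 hle) ?_⟩
    rintro rfl
    exact hd hc

theorem savScore_sumElim {C I J : Type*} [Fintype I] [Fintype J] [DecidableEq C]
    (A : I → Finset C) (B : J → Finset C) (c : C) :
    savScore (Sum.elim A B) c = savScore A c + savScore B c := by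
  simp only [savScore, Finset.sum_filter, Fintype.sum_sum_type, Sum.elim_inl, Sum.elim_inr]
  rfl

theorem savScore_nonneg {C I : Type*} [Fintype I] [DecidableEq C]
    (A : I → Finset C) (c : C) : 0 ≤ savScore A c :=
  Finset.sum_nonneg fun _ _ => by positivity

theorem savScore_le_savScore_singleton {C I : Type*} [Fintype I] [DecidableEq C]
    (B : I → Finset C) (p : C) :
    savScore B p ≤ savScore (fun _ : I => ({p} : Finset C)) p := by
  simp only [savScore, Finset.sum_filter]
  refine Finset.sum_le_sum fun i _ => ?_
  split_ifs with h
  · have hpos : (1 : ℚ) ≤ (B i).card := by exact_mod_cast Finset.card_pos.2 ⟨p, h⟩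
    simpa using inv_le_one_of_one_le₀ hpos
  · simp_all
  · simp
  · simp

theorem savScore_singleton_of_ne {C I : Type*} [Fintype I] [DecidableEq C]
    {p c : C} (h : c ≠ p) : savScore (fun _ : I => ({p} : Finset C)) c = 0 := by
  simp [savScore, h]

/-- If `j` additional agents can cast nonempty ballots `B₁, …, B_j` making `p` a
member of the SAV winning set, then `p` is also a member of the SAV winning set
when each of the `j` additional agents casts the singleton ballot `{p}`:
approving only `p` is optimal for making `p` a winner under SAV. -/
theorem sav_singleton_ballots_optimal
    {C : Type*} [Fintype C] [LinearOrder C] {n j : ℕ}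
    (A : Fin n → Finset C) (hA : ∀ i, (A i).Nonempty)
    (k : ℕ) (hk : k ≤ Fintype.card C) (p : C)
    (B : Fin j → Finset C) (hB : ∀ i, (B i).Nonempty)
    (W : Finset C)
    (hW : IsSAVWinningSet (Sum.elim A B) (· < ·) k W) (hpW : p ∈ W) :
    ∃ W' : Finset C,
      IsSAVWinningSet (Sum.elim A (fun _ : Fin j => ({p} : Finset C))) (· < ·) k W' ∧
      p ∈ W' := by
  obtain ⟨W', hW'⟩ :=
    exists_isSAVWinningSet (Sum.elim A (fun _ : Fin j => ({p} : Finset C))) hk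
  refine ⟨W', hW', ?_⟩
  by_contra hp
  obtain ⟨d, hdW', hdW⟩ : ∃ d ∈ W', d ∉ W := by
    by_contra! hsub
    have heq : W' = W := Finset.eq_of_subset_of_card_le hsub (by rw [hW.1, hW'.1])
    exact hp (heq ▸ hpW)
  have hdp : d ≠ p := by
    rintro rfl
    exact hdW hpW
  have hold := hW.2 p hpW d hdW
  have hnew := hW'.2 d hdW' p hp
  simp only [savScore_sumElim, savScore_singleton_of_ne hdp] at hold hnew
  have hp_le := savScore_le_savScore_singleton B p
  have hd_nonneg := savScore_nonneg B d
  rcases hold with hold | ⟨hold, hlt⟩ <;> rcases hnew with hnew | ⟨hnew, hgt⟩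
  · linarith
  · linarith
  · linarith
  · exact lt_asymm hlt hgt
end

section
/- Multi-winner approval voting (AV) with tie-breaking by a fixed linear order is strategyproof for dichotomous preferences: fix a finite candidate set C, a committee size k ≤ |C|, a tie-breaking linear order ≻ on C, ballots A_2, …, A_n ⊆ C, and an agent 1 with truthful approval set T ⊆ C. Then for every ballot B ⊆ C, |W(T) ∩ T| ≥ |W(B) ∩ T|, where for a ballot X the committee W(X) is the AV winning set of the profile (X, A_2, …, A_n); that is, reporting the truthful ballot T maximizes agent 1's dichotomous utility. -/
open Finset

/-- The AV approval score of candidate `c`: the number of agents approving `c`. -/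
def avScore {C I : Type*} [Fintype I] [DecidableEq C] (A : I → Finset C) (c : C) : ℕ :=
  (Finset.univ.filter (fun i => c ∈ A i)).card

/-- `W` is the AV winning set of size `k` for the profile `A` with tie-breaking
order `prec` (`prec c d` meaning that `c` is earlier, i.e. preferred, in the
tie-breaking order): `W` consists of the `k` candidates with highest approval
score, ties broken in favor of earlier candidates. -/
def IsAVWinningSet {C I : Type*} [Fintype I] [DecidableEq C]
    (A : I → Finset C) (prec : C → C → Prop) (k : ℕ) (W : Finset C) : Prop :=
  W.card = k ∧ ∀ c ∈ W, ∀ d, d ∉ W →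
    avScore A d < avScore A c ∨ (avScore A d = avScore A c ∧ prec c d)

theorem avScore_cons {C : Type*} [DecidableEq C] {n : ℕ} (X : Finset C)
    (A : Fin n → Finset C) (c : C) :
    avScore (Fin.cons X A : Fin (n + 1) → Finset C) c =
      (if c ∈ X then 1 else 0) + avScore A c := by
  simp only [avScore, Finset.card_filter, Fin.sum_univ_succ, Fin.cons_zero, Fin.cons_succ]

/-- Multi-winner approval voting with tie-breaking by a fixed linear order is
strategyproof for dichotomous preferences: for any ballots `A_2, …, A_n`, any
truthful approval set `T` of agent 1, and any alternative ballot `B`, the AV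
winning set obtained by reporting `T` gives agent 1 at least as much
dichotomous utility `|W ∩ T|` as the one obtained by reporting `B`. -/
theorem av_strategyproof
    {C : Type*} [Fintype C] [LinearOrder C] {n : ℕ}
    (A : Fin n → Finset C) (k : ℕ) (hk : k ≤ Fintype.card C)
    (T B : Finset C) (WT WB : Finset C)
    (hT : IsAVWinningSet (Fin.cons T A) (· < ·) k WT)
    (hB : IsAVWinningSet (Fin.cons B A) (· < ·) k WB) :
    (WB ∩ T).card ≤ (WT ∩ T).card := by
  by_contra! h
  obtain ⟨a, haB, haT⟩ := Finset.exists_mem_notMem_of_card_lt_card h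
  have hsdiff : (WB \ T).card < (WT \ T).card := by
    have h₁ := Finset.card_inter_add_card_sdiff WB T
    have h₂ := Finset.card_inter_add_card_sdiff WT T
    have h₃ := hT.1
    have h₄ := hB.1
    omega
  obtain ⟨b, hbT, hbB⟩ := Finset.exists_mem_notMem_of_card_lt_card hsdiff
  simp only [Finset.mem_inter, Finset.mem_sdiff, not_and, not_not] at haB haT hbT hbB
  have haWT : a ∉ WT := fun ha => haT ha haB.2
  have hbWB : b ∉ WB := fun hb => hbT.2 (hbB hb)
  have h₁ := hT.2 b hbT.1 a haWT
  have h₂ := hB.2 a haB.1 b hbWB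
  simp only [avScore_cons, if_pos haB.2, if_neg hbT.2] at h₁ h₂
  grind
end
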